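/- arXiv:2209.12032 — 2 statements merged into one kernel-verified Lean document; each statement's English description precedes it below -/
import Mathlib

section
/- Let Γ ⊆ GLₙ(ℂ) be a subgroup such that every element g ∈ Γ satisfies g^d = 1 for a fixed positive integer d. Then Γ is finite and its order divides d^n. (Effective Burnside theorem of Herzog–Praeger.) -/
open Matrix

open Module in
/-- An endomorphism of finite order of a complex vector space is diagonalizable, with roots of
unity as eigenvalues. -/
theorem exists_eigenbasis_of_pow_eq_one {V : Type*} [AddCommGroup V] [Module ℂ V]
    [FiniteDimensional ℂ V] {n d : ℕ} (hV : finrank ℂ V = n) (hd : 0 < d) {f : End ℂ V}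
    (hf : f ^ d = 1) :
    ∃ (b : Basis (Fin n) ℂ V) (μ : Fin n → ℂ), (∀ i, f (b i) = μ i • b i) ∧ ∀ i, μ i ^ d = 1 := by
  have hss : f.IsSemisimple := by
    refine End.isSemisimple_of_squarefree_aeval_eq_zero (p := .X ^ d - 1) ?_ (by simp [hf])
    exact (Polynomial.X_pow_sub_one_separable_iff.mpr (by exact_mod_cast hd.ne')).squarefree
  have hspan : ⊤ ≤ Submodule.span ℂ {v : V | ∃ μ : ℂ, f.HasEigenvector μ v} := by
    rw [← hss.iSup_eigenspace_eq_top, iSup_le_iff]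
    intro μ v hv
    rcases eq_or_ne v 0 with rfl | hv0
    · exact Submodule.zero_mem _
    · exact Submodule.subset_span ⟨μ, hv, hv0⟩
  let b₀ := Basis.ofSpan hspan
  have := FiniteDimensional.fintypeBasisIndex b₀
  let b := b₀.reindex (Fintype.equivFinOfCardEq ((finrank_eq_card_basis b₀).symm.trans hV))
  have hb (i) : ∃ μ : ℂ, f.HasEigenvector μ (b i) := by
    refine Basis.ofSpan_subset hspan ⟨(Fintype.equivFinOfCardEq
      ((finrank_eq_card_basis b₀).symm.trans hV)).symm i, ?_⟩
    simp [b, b₀]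
  choose μ hμ using hb
  refine ⟨b, μ, fun i ↦ (hμ i).apply_eq_smul, fun i ↦ ?_⟩
  have h := (hμ i).pow_apply d
  rw [hf, End.one_apply] at h
  refine smul_left_injective ℂ (hμ i).2 ?_
  simp [← h]

/-- The trace of an exterior power of a diagonalizable endomorphism is an elementary symmetric
function of its eigenvalues. -/
theorem trace_exteriorPower_map_of_eigenbasis {K V I : Type*} [Field K] [AddCommGroup V]
    [Module K V] [Fintype I] [LinearOrder I] {f : Module.End K V} (b : Module.Basis I K V)
    {μ : I → K} (hf : ∀ i, f (b i) = μ i • b i) (k : ℕ) :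
    LinearMap.trace K _ (exteriorPower.map k f) =
      ∑ s ∈ Finset.univ.powersetCard k, ∏ i ∈ s, μ i := by
  classical
  have h (s : Set.powersetCard I k) : exteriorPower.map k f (b.exteriorPower k s) =
      (∏ i ∈ s.1, μ i) • b.exteriorPower k s := by
    simp only [exteriorPower.basis_apply, exteriorPower.ιMulti_family,
      exteriorPower.map_apply_ιMulti]
    have hprod : ∏ i ∈ s.1, μ i = ∏ j, μ (Set.powersetCard.ofFinEmbEquiv.symm s j) := by
      rw [Set.powersetCard.ofFinEmbEquiv_symm_apply]
      conv_lhs => rw [← Finset.map_orderEmbOfFin_univ s.1 s.2]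
      rw [Finset.prod_map]
      rfl
    rw [hprod]
    refine Eq.trans (congrArg _ ?_) ((exteriorPower.ιMulti K k).toMultilinearMap.map_smul_univ _ _)
    ext1 j
    simp [hf]
  rw [LinearMap.trace_eq_matrix_trace K (b.exteriorPower k), Matrix.trace]
  simp only [Matrix.diag_apply, LinearMap.toMatrix_apply, h, map_smul, Finsupp.smul_apply,
    Module.Basis.repr_self, Finsupp.single_eq_same, smul_eq_mul, mul_one]
  exact (Finset.sum_subtype _ (by simp [Set.powersetCard]) fun s ↦ ∏ i ∈ s, μ i).symm

/-- The `k`-th exterior power of a representation. -/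
noncomputable def Representation.exteriorPow {k G V : Type*} [CommRing k] [Monoid G]
    [AddCommGroup V] [Module k V] (ρ : Representation k G V) (m : ℕ) :
    Representation k G (⋀[k]^m V) where
  toFun g := exteriorPower.map m (ρ g)
  map_one' := by rw [map_one]; exact exteriorPower.map_id
  map_mul' g h := by rw [map_mul]; exact exteriorPower.map_comp _ _

open Module in
/-- The characteristic polynomial of `ρ g` up to sign, evaluated at `z` and expanded in terms of
the characters of the exterior powers of `ρ`. -/
theorem Representation.sum_character_exteriorPow {G V : Type*} [Monoid G] [AddCommGroup V]
    [Module ℂ V] {n : ℕ} (ρ : Representation ℂ G V) (g : G) (b : Basis (Fin n) ℂ V) (μ : Fin n → ℂ)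
    (hb : ∀ i, ρ g (b i) = μ i • b i) (z : ℂ) :
    ∑ k ∈ Finset.range (n + 1), (-z) ^ (n - k) * (ρ.exteriorPow k).character g =
      ∏ i, (μ i - z) := by
  simp_rw [sub_eq_add_neg, Finset.prod_add, Finset.sum_powerset, Finset.card_univ, Fintype.card_fin]
  refine Finset.sum_congr rfl fun k _ ↦ ?_
  have : (ρ.exteriorPow k).character g = ∑ s ∈ Finset.univ.powersetCard k, ∏ i ∈ s, μ i :=
    trace_exteriorPower_map_of_eigenbasis b hb k
  rw [this, Finset.mul_sum]
  refine Finset.sum_congr rfl fun s hs ↦ ?_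
  rw [Finset.prod_const, Finset.card_sdiff_of_subset (Finset.subset_univ s),
    (Finset.mem_powersetCard.mp hs).2, Finset.card_univ, Fintype.card_fin, mul_comm]

/-- The average over a finite group of a product of combinations of characters with algebraic
integer coefficients is an algebraic integer. -/
theorem Representation.isIntegral_average_prod_mul_character {G : Type} [Group G] [Fintype G]
    {V : ℕ → Type} [∀ k, AddCommGroup (V k)] [∀ k, Module ℂ (V k)]
    [∀ k, FiniteDimensional ℂ (V k)] (ρ : ∀ k, Representation ℂ G (V k)) {ι : Type*}
    (T : Finset ι) (S : Finset ℕ) (c : ι → ℕ → ℂ) (hc : ∀ i ∈ T, ∀ k, IsIntegral ℤ (c i k))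
    {W : Type} [AddCommGroup W] [Module ℂ W] [FiniteDimensional ℂ W] (σ : Representation ℂ G W) :
    IsIntegral ℤ ((Nat.card G : ℂ)⁻¹ *
      ∑ g, (∏ i ∈ T, ∑ k ∈ S, c i k * (ρ k).character g) * σ.character g) := by
  classical
  induction T using Finset.induction_on generalizing W with
  | empty =>
    have : Invertible (Nat.card G : ℂ) := invertibleOfNonzero (by simp)
    simp only [Finset.prod_empty, one_mul, σ.card_inv_mul_sum_char_eq_finrank]
    exact isIntegral_algebraMap (R := ℤ) (x := (Module.finrank ℂ σ.invariants : ℤ))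
  | insert i T hi ih =>
    have h : (Nat.card G : ℂ)⁻¹ *
        ∑ g, (∏ j ∈ insert i T, ∑ k ∈ S, c j k * (ρ k).character g) * σ.character g =
        ∑ k ∈ S, c i k * ((Nat.card G : ℂ)⁻¹ * ∑ g,
          (∏ j ∈ T, ∑ k ∈ S, c j k * (ρ k).character g) * ((ρ k).tprod σ).character g) := by
      simp_rw [Finset.prod_insert hi, Representation.char_tensor, Pi.mul_apply, Finset.mul_sum]
      rw [Finset.sum_comm]
      refine Finset.sum_congr rfl fun g _ ↦ ?_
      rw [Finset.sum_mul, Finset.sum_mul, Finset.mul_sum]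
      refine Finset.sum_congr rfl fun k _ ↦ ?_
      ring
    rw [h]
    exact IsIntegral.sum _ fun k _ ↦ (hc i (Finset.mem_insert_self i T) k).mul
      (ih (fun j hj ↦ hc j (Finset.mem_insert_of_mem hj)) _)

open Polynomial in
theorem prod_nthRootsFinset_erase_one_sub {d : ℕ} (hd : 0 < d) (x : ℂ) :
    ∏ z ∈ (nthRootsFinset d (1 : ℂ)).erase 1, (x - z) = ∑ i ∈ Finset.range d, x ^ i := by
  have h1 : (1 : ℂ) ∈ nthRootsFinset d (1 : ℂ) := by simp [mem_nthRootsFinset hd]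
  have h : (X - 1 : ℂ[X]) * ∏ z ∈ (nthRootsFinset d (1 : ℂ)).erase 1, (X - C z) =
      (X - 1) * ∑ i ∈ Finset.range d, X ^ i := by
    rw [mul_geom_sum, X_pow_sub_one_eq_prod hd (Complex.isPrimitiveRoot_exp d hd.ne'),
      ← Finset.mul_prod_erase _ _ h1, C_1]
  have h2 := congrArg (eval x) (mul_left_cancel₀ (X_sub_C_ne_zero 1) h)
  simpa [eval_prod, eval_finsetSum] using h2

/-- A finite group of exponent dividing `d` with a faithful complex representation of degree `n`
has order dividing `d ^ n`. -/
theorem Representation.card_dvd_pow_finrank {G V : Type} [Group G] [Finite G] [AddCommGroup V]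
    [Module ℂ V] [FiniteDimensional ℂ V] (ρ : Representation ℂ G V)
    (hρ : Function.Injective ρ) {d : ℕ} (hd : 0 < d) (h : ∀ g : G, g ^ d = 1) :
    Nat.card G ∣ d ^ Module.finrank ℂ V := by
  classical
  have := Fintype.ofFinite G
  set n := Module.finrank ℂ V with hn
  let T := (Polynomial.nthRootsFinset d (1 : ℂ)).erase 1
  let F (g : G) : ℂ := ∏ z ∈ T, ∑ k ∈ Finset.range (n + 1),
    (-z) ^ (n - k) * (ρ.exteriorPow k).character g
  have hF (g : G) : F g = if g = 1 then (d : ℂ) ^ n else 0 := by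
    obtain ⟨b, μ, hb, hμ⟩ := exists_eigenbasis_of_pow_eq_one hn.symm hd
      (show ρ g ^ d = 1 by rw [← map_pow, h, map_one])
    simp only [F, ρ.sum_character_exteriorPow g b μ hb]
    rw [Finset.prod_comm]
    simp only [T, prod_nthRootsFinset_erase_one_sub hd]
    split_ifs with hg
    · have hμ1 (i) : μ i = 1 := by
        have hi := hb i
        rw [hg, map_one, Module.End.one_apply] at hi
        refine smul_left_injective ℂ (b.ne_zero i) ?_
        simp [← hi]
      simp [hμ1]
    · obtain ⟨i, hi⟩ : ∃ i, μ i ≠ 1 := by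
        by_contra! hall
        refine hg (hρ ?_)
        rw [map_one]
        exact b.ext fun i ↦ by simp [hb, hall]
      refine Finset.prod_eq_zero (Finset.mem_univ i) (mul_left_cancel₀ (sub_ne_zero.mpr hi) ?_)
      rw [mul_geom_sum, hμ, sub_self, mul_zero]
  have key := Representation.isIntegral_average_prod_mul_character (fun k ↦ ρ.exteriorPow k) T
    (Finset.range (n + 1)) (fun z k ↦ (-z) ^ (n - k)) (fun z hz k ↦ ?_)
    (Representation.trivial ℂ G ℂ)
  · have hsum : ∑ g, F g * (Representation.trivial ℂ G ℂ).character g = (d : ℂ) ^ n := by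
      simp [hF, Representation.character]
    rw [hsum] at key
    have hq : IsIntegral ℤ ((Nat.card G : ℚ)⁻¹ * (d : ℚ) ^ n) := by
      rw [← isIntegral_algebraMap_iff (algebraMap ℚ ℂ).injective]
      simpa using key
    obtain ⟨m, hm⟩ := IsIntegrallyClosed.isIntegral_iff.mp hq
    have hG : (Nat.card G : ℚ) ≠ 0 := by simp
    rw [← Int.natCast_dvd_natCast]
    refine ⟨m, ?_⟩
    have : (d : ℚ) ^ n = Nat.card G * m := by
      rw [show (m : ℚ) = _ from hm, mul_inv_cancel_left₀ hG]
    exact_mod_cast this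
  · refine (IsIntegral.neg (IsIntegral.of_pow hd ?_)).pow _
    rw [(Polynomial.mem_nthRootsFinset hd _).mp (Finset.mem_of_mem_erase hz)]
    exact isIntegral_one

theorem Matrix.exists_eigenvalues_of_pow_eq_one {n d : ℕ} (hd : 0 < d)
    {A : Matrix (Fin n) (Fin n) ℂ} (hA : A ^ d = 1) :
    ∃ μ : Fin n → ℂ, (∀ i, μ i ^ d = 1) ∧ A.trace = ∑ i, μ i ∧ ((∀ i, μ i = 1) → A = 1) := by
  obtain ⟨b, μ, hb, hμ⟩ := exists_eigenbasis_of_pow_eq_one (V := Fin n → ℂ) (n := n) (by simp) hd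
    (f := A.toLin') (by rw [← Matrix.toLin'_pow, hA, Matrix.toLin'_one]; rfl)
  refine ⟨μ, hμ, ?_, fun h1 ↦ Matrix.toLin'.injective (b.ext fun i ↦ ?_)⟩
  · rw [← Matrix.trace_toLin'_eq, LinearMap.trace_eq_matrix_trace ℂ b, Matrix.trace]
    simp [LinearMap.toMatrix_apply, hb, -Matrix.toLin'_apply]
  · rw [hb, h1, one_smul, Matrix.toLin'_one, LinearMap.id_apply]

/-- A matrix of finite order whose trace is its size is the identity. -/
theorem Matrix.eq_one_of_pow_eq_one_of_trace_eq {n d : ℕ} (hd : 0 < d)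
    {A : Matrix (Fin n) (Fin n) ℂ} (hA : A ^ d = 1) (htr : A.trace = n) : A = 1 := by
  obtain ⟨μ, hμ, hsum, h1⟩ := Matrix.exists_eigenvalues_of_pow_eq_one hd hA
  have hnorm (i) : ‖μ i‖ = 1 := Complex.norm_eq_one_of_pow_eq_one (hμ i) hd.ne'
  have hre (i) : (μ i).re ≤ 1 := (Complex.re_le_norm _).trans (hnorm i).le
  have hsum_re : ∑ i, (μ i).re = ∑ _i : Fin n, (1 : ℝ) := by
    rw [← Complex.re_sum, ← hsum, htr]
    simp
  refine h1 fun i ↦ ?_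
  have hi : (μ i).re = 1 :=
    (Finset.sum_eq_sum_iff_of_le fun i _ ↦ hre i).mp hsum_re i (Finset.mem_univ i)
  have hsq := Complex.sq_norm (μ i)
  rw [hnorm, Complex.normSq_apply, hi] at hsq
  exact Complex.ext hi (by simpa using hsq)

theorem Matrix.finite_trace_image_of_pow_eq_one {n d : ℕ} (hd : 0 < d) :
    (Matrix.trace '' {A : Matrix (Fin n) (Fin n) ℂ | A ^ d = 1}).Finite := by
  refine ((Set.Finite.pi' fun _ : Fin n ↦
    (Polynomial.nthRootsFinset d (1 : ℂ)).finite_toSet).image fun μ ↦ ∑ i, μ i).subset ?_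
  rintro _ ⟨A, hA, rfl⟩
  obtain ⟨μ, hμ, hsum, -⟩ := Matrix.exists_eigenvalues_of_pow_eq_one hd hA
  exact ⟨μ, fun i ↦ by simp [Polynomial.mem_nthRootsFinset hd, hμ], hsum.symm⟩

/-- Burnside: a complex linear group of finite exponent is finite. -/
theorem finite_of_forall_pow_eq_one {n d : ℕ} (hd : 0 < d) (Γ : Subgroup (GL (Fin n) ℂ))
    (h : ∀ g ∈ Γ, g ^ d = 1) : Finite Γ := by
  have hpow (g : Γ) : ((g : GL (Fin n) ℂ) : Matrix (Fin n) (Fin n) ℂ) ^ d = 1 := by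
    rw [← Units.val_pow_eq_pow_val, h g g.2, Units.val_one]
  obtain ⟨B, hBsub, hBspan, hBli⟩ := exists_linearIndependent ℂ
    (Set.range fun g : Γ ↦ ((g : GL (Fin n) ℂ) : Matrix (Fin n) (Fin n) ℂ))
  have : Finite B := hBli.finite
  have := (Matrix.finite_trace_image_of_pow_eq_one (n := n) hd).to_subtype
  let t (g : Γ) (x : B) : Matrix.trace '' {A : Matrix (Fin n) (Fin n) ℂ | A ^ d = 1} :=
    ⟨(((g : GL (Fin n) ℂ) : Matrix (Fin n) (Fin n) ℂ) * x).trace, by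
      obtain ⟨k, hk⟩ := hBsub x.2
      exact ⟨_, hk ▸ hpow (g * k), rfl⟩⟩
  refine Finite.of_injective t fun g₁ g₂ hg ↦ ?_
  have htr (x : Γ) : ((g₁ * x : GL (Fin n) ℂ) : Matrix (Fin n) (Fin n) ℂ).trace =
      ((g₂ * x : GL (Fin n) ℂ) : Matrix (Fin n) (Fin n) ℂ).trace := by
    have hx : ((x : GL (Fin n) ℂ) : Matrix (Fin n) (Fin n) ℂ) ∈ Submodule.span ℂ B :=
      hBspan ▸ Submodule.subset_span ⟨x, rfl⟩
    rw [Units.val_mul, Units.val_mul]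
    generalize ((x : GL (Fin n) ℂ) : Matrix (Fin n) (Fin n) ℂ) = X at hx ⊢
    induction hx using Submodule.span_induction with
    | mem y hy => exact congrArg Subtype.val (congrFun hg ⟨y, hy⟩)
    | zero => simp
    | add y z _ _ hy hz => simp [mul_add, hy, hz]
    | smul c y _ hy => simp [hy]
  have h1 := htr g₂⁻¹
  rw [InvMemClass.coe_inv, mul_inv_cancel, Units.val_one, Matrix.trace_one, Fintype.card_fin] at h1
  have h2 := Matrix.eq_one_of_pow_eq_one_of_trace_eq hd (hpow (g₁ * g₂⁻¹)) h1
  exact mul_inv_eq_one.mp (Subtype.ext (Units.ext h2))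

theorem effective_burnside (n d : ℕ) (hn : 0 < n) (hd : 0 < d)
    (Γ : Subgroup (GL (Fin n) ℂ)) (h : ∀ g ∈ Γ, g ^ d = 1) :
    Finite Γ ∧ Nat.card Γ ∣ d ^ n := by
  have hfin := finite_of_forall_pow_eq_one hd Γ h
  refine ⟨hfin, ?_⟩
  let ρ : Representation ℂ Γ (Fin n → ℂ) :=
    (Matrix.toLinAlgEquiv' : Matrix (Fin n) (Fin n) ℂ ≃ₐ[ℂ] _).toMonoidHom.comp
      ((Units.coeHom _).comp Γ.subtype)
  have hρ : Function.Injective ρ := fun g₁ g₂ hg ↦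
    Subtype.ext (Units.ext (Matrix.toLinAlgEquiv'.injective hg))
  simpa using ρ.card_dvd_pow_finrank hρ hd fun g ↦ Subtype.ext (h g g.2)
end

section
/- Let V be an n-dimensional complex vector space and Γ ⊆ GL(V) a subgroup such that every eigenvalue α of every element of Γ satisfies [ℚ(α):ℚ] ≤ C for a fixed constant C. Then every finite subgroup of Γ has order at most 2^(n²) · C^(2n²). -/
/-- The prime preceding `p` (and `2` for `p = 2`). -/
noncomputable def Nat.prevPrime (p : ℕ) : ℕ := Nat.nth Nat.Prime (Nat.count Nat.Prime p - 1)

theorem Nat.prime_prevPrime (p : ℕ) : (Nat.prevPrime p).Prime :=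
  Nat.prime_nth_prime _

theorem Nat.count_prime_pos {p : ℕ} (hp : 3 ≤ p) : 0 < Nat.count Nat.Prime p :=
  lt_of_lt_of_le (by decide) (Nat.count_monotone Nat.Prime hp)

theorem Nat.nth_count_prevPrime {p : ℕ} (hp : p.Prime) (h3 : 3 ≤ p) :
    Nat.nth Nat.Prime (Nat.count Nat.Prime (Nat.prevPrime p) + 1) = p := by
  rw [Nat.prevPrime, Nat.count_nth_of_infinite Nat.infinite_setOfPred_prime,
    Nat.sub_add_cancel (Nat.count_prime_pos h3), Nat.nth_count hp]

theorem Nat.prevPrime_lt {p : ℕ} (hp : p.Prime) (h3 : 3 ≤ p) : Nat.prevPrime p < p := by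
  conv_rhs => rw [← Nat.nth_count hp]
  exact (Nat.nth_lt_nth Nat.infinite_setOfPred_prime).2
    (Nat.sub_lt (Nat.count_prime_pos h3) one_pos)

theorem Nat.three_le_prevPrime {p : ℕ} (h5 : 4 ≤ p) : 3 ≤ Nat.prevPrime p := by
  rw [← Nat.nth_prime_one_eq_three]
  refine (Nat.nth_le_nth Nat.infinite_setOfPred_prime).2 ?_
  have : Nat.count Nat.Prime 4 ≤ Nat.count Nat.Prime p := Nat.count_monotone Nat.Prime h5
  have h : Nat.count Nat.Prime 4 = 2 := by decide
  omega

/-- The completely multiplicative shift replacing each prime factor by the preceding prime. -/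
noncomputable def Nat.primeShift (m : ℕ) : ℕ := (m.primeFactorsList.map Nat.prevPrime).prod

theorem Nat.three_le_of_mem_primeFactorsList {m p : ℕ} (hm : ¬ 2 ∣ m)
    (hp : p ∈ m.primeFactorsList) : 3 ≤ p := by
  have h2 := (Nat.prime_of_mem_primeFactorsList hp).two_le
  have hd := Nat.dvd_of_mem_primeFactorsList hp
  rcases h2.eq_or_lt with rfl | h
  · exact absurd hd hm
  · exact h

theorem Nat.primeShift_le_totient {m : ℕ} (hm : ¬ 2 ∣ m) : Nat.primeShift m ≤ m.totient := by
  have key : ∀ L : List ℕ, (∀ p ∈ L, p.Prime ∧ 3 ≤ p) →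
      (L.map Nat.prevPrime).prod ≤ L.prod.totient := by
    intro L
    induction L with
    | nil => simp
    | cons p L ih =>
      intro h
      have hp := h p (by simp)
      rw [List.map_cons, List.prod_cons, List.prod_cons]
      refine le_trans (Nat.mul_le_mul ?_ (ih fun q hq => h q (by simp [hq])))
        (Nat.totient_super_multiplicative _ _)
      rw [Nat.totient_prime hp.1]
      exact Nat.le_sub_one_of_lt (Nat.prevPrime_lt hp.1 hp.2)
  have h := key m.primeFactorsList fun p hp =>
    ⟨Nat.prime_of_mem_primeFactorsList hp, Nat.three_le_of_mem_primeFactorsList hm hp⟩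
  rwa [Nat.prod_primeFactorsList (by rintro rfl; simp at hm)] at h

theorem Nat.primeShift_injOn : Set.InjOn Nat.primeShift {m | ¬ 2 ∣ m} := by
  intro a ha b hb hab
  have hperm : ∀ m : ℕ, (m.primeFactorsList.map Nat.prevPrime).Perm
      (Nat.primeShift m).primeFactorsList := fun m =>
    Nat.primeFactorsList_unique rfl fun q hq => by
      obtain ⟨p, -, rfl⟩ := List.mem_map.1 hq
      exact Nat.prime_prevPrime p
  have hrec : ∀ m : ℕ, ¬ 2 ∣ m → ((m.primeFactorsList.map Nat.prevPrime).map
      fun q => Nat.nth Nat.Prime (Nat.count Nat.Prime q + 1)).prod = m := by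
    intro m hm
    rw [List.map_map]
    conv_rhs => rw [← Nat.prod_primeFactorsList (n := m) (by rintro rfl; simp at hm)]
    congr 1
    conv_rhs => rw [← List.map_id m.primeFactorsList]
    refine List.map_congr_left fun p hp => ?_
    exact Nat.nth_count_prevPrime (Nat.prime_of_mem_primeFactorsList hp)
      (Nat.three_le_of_mem_primeFactorsList hm hp)
  rw [← hrec a ha, ← hrec b hb]
  refine List.Perm.prod_eq (List.Perm.map _ ?_)
  exact (hperm a).trans (hab ▸ (hperm b).symm)

theorem Nat.not_two_dvd_primeShift {m : ℕ} (h2 : ¬ 2 ∣ m) (h3 : ¬ 3 ∣ m) :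
    ¬ 2 ∣ Nat.primeShift m := by
  rw [Nat.primeShift, Nat.prime_two.prime.dvd_prod_iff]
  rintro ⟨q, hq, h2q⟩
  obtain ⟨p, hp, rfl⟩ := List.mem_map.1 hq
  have hp3 := Nat.three_le_of_mem_primeFactorsList h2 hp
  have hne : p ≠ 3 := by
    rintro rfl
    exact h3 (Nat.dvd_of_mem_primeFactorsList hp)
  have := Nat.three_le_prevPrime (p := p) (by omega)
  have := (Nat.prime_dvd_prime_iff_eq Nat.prime_two (Nat.prime_prevPrime p)).1 h2q
  omega

theorem Nat.sq_mul_div_sq_le (k y : ℕ) : k ^ 2 * (y / k) ^ 2 ≤ y ^ 2 := by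
  rw [← mul_pow]
  exact Nat.pow_le_pow_left (Nat.mul_div_le y k) 2

/-- The sum of `φ m` over `m < N` satisfying `P` and `φ m ≤ y`. -/
def totientSum (P : ℕ → Prop) [DecidablePred P] (N y : ℕ) : ℕ :=
  ∑ m ∈ Finset.range N with P m ∧ m.totient ≤ y, m.totient

theorem totientSum_zero (P : ℕ → Prop) [DecidablePred P] (N : ℕ) : totientSum P N 0 = 0 :=
  Finset.sum_eq_zero fun m hm => by simpa using (Finset.mem_filter.1 hm).2.2

theorem totientSum_split (P Q : ℕ → Prop) [DecidablePred P] [DecidablePred Q] (N y : ℕ) :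
    totientSum P N y =
      totientSum (fun m => P m ∧ ¬ Q m) N y + totientSum (fun m => P m ∧ Q m) N y := by
  simp only [totientSum]
  rw [← Finset.sum_filter_not_add_sum_filter _ Q]
  simp only [Finset.filter_filter]
  congr 2 <;> ext m <;> simp only [Finset.mem_filter] <;> tauto

theorem totientSum_dvd_le (P : ℕ → Prop) [DecidablePred P] {p : ℕ} (hp : p.Prime)
    (hP : ∀ k, P (p * k) → P k) (N y : ℕ) :
    totientSum (fun m => P m ∧ p ∣ m) N y ≤
      (p - 1) * totientSum (fun m => P m ∧ ¬ p ∣ m) N (y / (p - 1)) +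
        p * totientSum (fun m => P m ∧ p ∣ m) N (y / p) := by
  have hp1 : 0 < p - 1 := Nat.sub_pos_of_lt hp.one_lt
  simp only [totientSum, Finset.mul_sum]
  set A := {m ∈ Finset.range N | (P m ∧ ¬ p ∣ m) ∧ m.totient ≤ y / (p - 1)} with hA
  set B := {m ∈ Finset.range N | (P m ∧ p ∣ m) ∧ m.totient ≤ y / p} with hB
  have hAB : Disjoint A B := by
    rw [Finset.disjoint_left]
    intro m h1 h2
    exact (Finset.mem_filter.1 h1).2.1.2 (Finset.mem_filter.1 h2).2.1.2
  have hAs : ∑ k ∈ A, (p - 1) * k.totient = ∑ k ∈ A, (p * k).totient :=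
    Finset.sum_congr rfl fun k hk =>
      (Nat.totient_mul_of_prime_of_not_dvd hp (Finset.mem_filter.1 hk).2.1.2).symm
  have hBs : ∑ k ∈ B, p * k.totient = ∑ k ∈ B, (p * k).totient :=
    Finset.sum_congr rfl fun k hk =>
      (Nat.totient_mul_of_prime_of_dvd hp (Finset.mem_filter.1 hk).2.1.2).symm
  rw [hAs, hBs, ← Finset.sum_union hAB, ← Finset.sum_image (f := Nat.totient) (g := fun k => p * k)
    (fun a _ b _ h => Nat.eq_of_mul_eq_mul_left hp.pos h)]
  refine Finset.sum_le_sum_of_subset fun m hm => ?_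
  obtain ⟨hmN, ⟨hmP, k, rfl⟩, hmy⟩ := Finset.mem_filter.1 hm
  refine Finset.mem_image.2 ⟨k, ?_, rfl⟩
  have hkN : k < N := lt_of_le_of_lt (Nat.le_mul_of_pos_left k hp.pos) (Finset.mem_range.1 hmN)
  by_cases hpk : p ∣ k
  · rw [Nat.totient_mul_of_prime_of_dvd hp hpk] at hmy
    refine Finset.mem_union_right _ (Finset.mem_filter.2 ⟨Finset.mem_range.2 hkN,
      ⟨hP k hmP, hpk⟩, (Nat.le_div_iff_mul_le hp.pos).2 (by linarith)⟩)
  · rw [Nat.totient_mul_of_prime_of_not_dvd hp hpk] at hmy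
    refine Finset.mem_union_left _ (Finset.mem_filter.2 ⟨Finset.mem_range.2 hkN,
      ⟨hP k hmP, hpk⟩, (Nat.le_div_iff_mul_le hp1).2 (by linarith)⟩)

theorem card_totient_le_of_coprime_six (N t : ℕ) :
    Finset.card {m ∈ Finset.range N | (¬ 2 ∣ m ∧ ¬ 3 ∣ m) ∧ m.totient ≤ 2 * t} ≤ t := by
  have : Finset.card ((Finset.range t).image fun i => 2 * i + 1) ≤ t :=
    Finset.card_image_le.trans (by simp)
  refine le_trans (Finset.card_le_card_of_injOn Nat.primeShift ?_ ?_) this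
  · intro m hm
    obtain ⟨-, ⟨h2, h3⟩, hy⟩ := Finset.mem_filter.1 hm
    have h1 := Nat.primeShift_le_totient h2
    have h4 := Nat.not_two_dvd_primeShift h2 h3
    exact Finset.mem_image.2 ⟨Nat.primeShift m / 2, Finset.mem_range.2 (by omega), by omega⟩
  · exact Nat.primeShift_injOn.mono fun m hm => (Finset.mem_filter.1 hm).2.1.1

theorem sq_le_sum_sub_of_coprime_six (y : ℕ) :
    y ^ 2 ≤ 6 * (∑ k ∈ Finset.range y with ¬ 2 ∣ k ∧ ¬ 3 ∣ k, (y - k)) + 1 := by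
  rw [Finset.sum_filter]
  induction y using Nat.strong_induction_on with
  | _ y ih =>
    by_cases h : y < 6
    · interval_cases y <;> decide
    · obtain ⟨z, rfl⟩ := Nat.exists_eq_add_of_le' (not_lt.1 h)
      have := ih z (by omega)
      rw [add_comm z 6, Finset.sum_range_add]
      have h1 : ∀ k, (if ¬ 2 ∣ 6 + k ∧ ¬ 3 ∣ 6 + k then 6 + z - (6 + k) else 0) =
          if ¬ 2 ∣ k ∧ ¬ 3 ∣ k then z - k else 0 := by
        intro k
        rw [Nat.add_sub_add_left]
        congr 1
        simp only [eq_iff_iff]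
        omega
      simp only [h1]
      have h2 : ∑ k ∈ Finset.range 6, (if ¬ 2 ∣ k ∧ ¬ 3 ∣ k then 6 + z - k else 0) =
          2 * z + 6 := by
        simp [Finset.sum_range_succ]
        omega
      rw [h2]
      nlinarith

theorem totientSum_coprime_six_even {N t : ℕ} (hN : 2 * t < N) :
    6 * totientSum (fun m => ¬ 2 ∣ m ∧ ¬ 3 ∣ m) N (2 * t) ≤ 2 * (2 * t) ^ 2 + 1 := by
  have hcard := card_totient_le_of_coprime_six N t
  have hsq := sq_le_sum_sub_of_coprime_six (2 * t)
  rw [totientSum]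
  set K := {m ∈ Finset.range N | (¬ 2 ∣ m ∧ ¬ 3 ∣ m) ∧ m.totient ≤ 2 * t} with hK
  have hle : ∑ k ∈ Finset.range (2 * t) with ¬ 2 ∣ k ∧ ¬ 3 ∣ k, (2 * t - k) ≤
      ∑ k ∈ K, (2 * t - k.totient) := by
    refine (Finset.sum_le_sum fun k _ => Nat.sub_le_sub_left (Nat.totient_le k) _).trans
      (Finset.sum_le_sum_of_subset fun k hk => ?_)
    obtain ⟨h1, h2⟩ := Finset.mem_filter.1 hk
    have h1 := Finset.mem_range.1 h1
    exact Finset.mem_filter.2 ⟨Finset.mem_range.2 (by omega), h2,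
      (Nat.totient_le k).trans (by omega)⟩
  have hsum : ∑ k ∈ K, k.totient + ∑ k ∈ K, (2 * t - k.totient) = K.card * (2 * t) := by
    rw [← Finset.sum_add_distrib, Finset.sum_const_nat]
    intro k hk
    exact Nat.add_sub_of_le (Finset.mem_filter.1 hk).2.2
  nlinarith

theorem totientSum_coprime_six_odd (N t : ℕ) (ht : 1 ≤ t) :
    totientSum (fun m => ¬ 2 ∣ m ∧ ¬ 3 ∣ m) N (2 * t + 1) =
      totientSum (fun m => ¬ 2 ∣ m ∧ ¬ 3 ∣ m) N (2 * t) := by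
  rw [totientSum, totientSum]
  congr 1
  refine Finset.filter_congr fun m _ => and_congr_right fun hm => ?_
  by_cases h : 2 < m
  · have := (Nat.totient_even h).two_dvd
    omega
  · have := Nat.totient_le m
    omega

theorem totientSum_coprime_six_one (N : ℕ) :
    totientSum (fun m => ¬ 2 ∣ m ∧ ¬ 3 ∣ m) N 1 ≤ 1 := by
  rw [totientSum]
  refine (Finset.sum_le_sum_of_subset (t := {1}) fun m hm => ?_).trans (by simp)
  obtain ⟨-, ⟨h2, h3⟩, h⟩ := Finset.mem_filter.1 hm
  rw [Finset.mem_singleton]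
  have h0 : 0 < m.totient := Nat.totient_pos.2 (by omega)
  have := Nat.totient_eq_one_iff.1 (le_antisymm h h0)
  omega

theorem totientSum_coprime_six_le {N y : ℕ} (hN : y < N) (hy : 2 ≤ y) :
    8 * totientSum (fun m => ¬ 2 ∣ m ∧ ¬ 3 ∣ m) N y ≤ 3 * y ^ 2 := by
  have h := totientSum_coprime_six_even (N := N) (t := y / 2) (by omega)
  rcases Nat.even_or_odd' y with ⟨t, rfl | rfl⟩
  · rw [Nat.mul_div_cancel_left t two_pos] at h
    nlinarith
  · rw [totientSum_coprime_six_odd N t (by omega)]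
    rw [show (2 * t + 1) / 2 = t by omega] at h
    nlinarith [show 1 ≤ t by omega]

theorem totientSum_three_dvd_le_two {N y : ℕ} (hy : y < 4) :
    totientSum (fun m => ¬ 2 ∣ m ∧ 3 ∣ m) N y ≤ 2 * (y / 2) := by
  have hrec := totientSum_dvd_le (fun m => ¬ 2 ∣ m) Nat.prime_three
    (fun k h => by omega) N
  have h1 := totientSum_coprime_six_one N
  have hr := hrec 1
  have hr' := hrec y
  interval_cases y <;> norm_num [totientSum_zero, -Nat.two_dvd_ne_zero] at hr hr' ⊢ <;> omega

theorem totientSum_three_dvd_le {N y : ℕ} (hN : y < N) (hy : 4 ≤ y) :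
    32 * totientSum (fun m => ¬ 2 ∣ m ∧ 3 ∣ m) N y ≤ 9 * y ^ 2 := by
  induction y using Nat.strong_induction_on with
  | _ y ih =>
    have hr := totientSum_dvd_le (fun m => ¬ 2 ∣ m) Nat.prime_three (fun k h => by omega) N y
    have hA := totientSum_coprime_six_le (N := N) (y := y / 2) (by omega) (by omega)
    norm_num [-Nat.two_dvd_ne_zero] at hr
    have hy2 : 4 * (y / 2) ^ 2 ≤ y ^ 2 := Nat.sq_mul_div_sq_le 2 y
    by_cases h12 : 12 ≤ y
    · have hE := ih (y / 3) (by omega) (by omega) (by omega)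
      have hy3 : 9 * (y / 3) ^ 2 ≤ y ^ 2 := Nat.sq_mul_div_sq_le 3 y
      omega
    · have hE := totientSum_three_dvd_le_two (N := N) (y := y / 3) (by omega)
      have hA4 := totientSum_coprime_six_even (N := N) (t := y / 2 / 2) (by omega)
      have hA3 := totientSum_coprime_six_odd N 1 le_rfl
      have hA5 := totientSum_coprime_six_odd N 2 one_le_two
      interval_cases y <;> norm_num [-Nat.two_dvd_ne_zero] at * <;> omega

theorem totientSum_odd_le {N y : ℕ} (hN : y < N) (hy : 3 ≤ y) :
    3 * totientSum (fun m => ¬ 2 ∣ m) N y ≤ 2 * y ^ 2 := by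
  rw [totientSum_split _ (fun m => 3 ∣ m)]
  have hA := totientSum_coprime_six_le hN (by omega)
  rcases hy.eq_or_lt with rfl | h
  · have := totientSum_three_dvd_le_two (N := N) (y := 3) (by omega)
    omega
  · have := totientSum_three_dvd_le hN h
    omega

theorem totientSum_odd_le_of_le_two {N y : ℕ} (hN : y < N) (hy : y ≤ 2) :
    totientSum (fun m => ¬ 2 ∣ m) N y ≤ 2 * y - 1 := by
  rw [totientSum_split _ (fun m => 3 ∣ m)]
  have hE := totientSum_three_dvd_le_two (N := N) (y := y) (by omega)
  have h1 := totientSum_coprime_six_one N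
  have h2 := totientSum_coprime_six_even (N := N) (t := y / 2) (by omega)
  interval_cases y <;> norm_num [totientSum_zero, -Nat.two_dvd_ne_zero] at * <;> omega

theorem totientSum_even_le {N y : ℕ} (hN : y < N) :
    3 * totientSum (fun m => True ∧ 2 ∣ m) N y ≤ 4 * y ^ 2 := by
  induction y using Nat.strong_induction_on with
  | _ y ih =>
    rcases Nat.eq_zero_or_pos y with rfl | hy
    · simp [totientSum_zero]
    have hr := totientSum_dvd_le (fun _ => True) Nat.prime_two (fun k h => h) N y
    have hE := ih (y / 2) (by omega) (by omega)
    simp only [true_and, Nat.add_one_sub_one, Nat.div_one, one_mul] at hr hE ⊢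
    by_cases h3 : 3 ≤ y
    · have hA := totientSum_odd_le hN h3
      have hy2 : 4 * (y / 2) ^ 2 ≤ y ^ 2 := Nat.sq_mul_div_sq_le 2 y
      omega
    · have hA := totientSum_odd_le_of_le_two hN (by omega)
      interval_cases y <;> norm_num [-Nat.two_dvd_ne_zero] at * <;> omega

theorem totientSum_le {N y : ℕ} (hN : y < N) :
    totientSum (fun _ => True) N y ≤ 2 * y ^ 2 := by
  rw [totientSum_split _ (fun m => 2 ∣ m)]
  have hE := totientSum_even_le hN
  simp only [true_and] at hE ⊢
  by_cases h3 : 3 ≤ y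
  · have hA := totientSum_odd_le hN h3
    omega
  · have hA := totientSum_odd_le_of_le_two hN (by omega)
    interval_cases y <;> norm_num [-Nat.two_dvd_ne_zero] at * <;> omega

open Polynomial in
theorem eq_one_of_pow_eq_one_of_forall_isUnit {A : Type*} [Ring A] [Algebra ℂ A] {a : A} {N : ℕ}
    (hN : 0 < N) (ha : a ^ N = 1)
    (h : ∀ ζ : ℂ, ζ ≠ 1 → IsUnit (a - algebraMap ℂ A ζ)) : a = 1 := by
  have h1 := X_pow_sub_one_eq_prod hN (Complex.isPrimitiveRoot_exp N hN.ne')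
  rw [← Finset.mul_prod_erase _ _ (one_mem_nthRootsFinset hN)] at h1
  have h2 := congrArg (aeval a) h1
  have hunit : IsUnit (aeval a (∏ ζ ∈ (nthRootsFinset N (1 : ℂ)).erase 1, (X - C ζ))) := by
    refine Finset.prod_induction _ (fun q => IsUnit (aeval a q)) ?_ (by simp) ?_
    · intro p q hp hq
      rw [map_mul]
      exact hp.mul hq
    · intro ζ hζ
      simpa using h ζ (Finset.ne_of_mem_erase hζ)
  rw [map_mul] at h2
  simp only [map_sub, map_pow, aeval_X, map_one, ha, sub_self] at h2
  exact sub_eq_zero.1 (hunit.mul_left_eq_zero.1 h2.symm)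

namespace MvPolynomial

theorem degreeOf_det_le_one {ι : Type*} [Fintype ι] [DecidableEq ι]
    (M : Matrix ι ι (MvPolynomial (ι × ι) ℂ))
    (hM : ∀ i j k, degreeOf k (M i j) ≤ if k = (i, j) then 1 else 0) (k : ι × ι) :
    degreeOf k M.det ≤ 1 := by
  rw [Matrix.det_apply]
  refine (degreeOf_sum_le k _ _).trans (Finset.sup_le fun σ _ => ?_)
  have h : degreeOf k (∏ i, M (σ i) i) ≤ 1 := by
    refine (degreeOf_prod_le k _ _).trans ((Finset.sum_le_sum fun i _ => hM (σ i) i k).trans ?_)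
    rw [← Finset.sum_filter_add_sum_filter_not _ (fun i => i = k.2)]
    rw [Finset.sum_filter, Finset.sum_ite_eq' , if_pos (Finset.mem_univ _), Finset.sum_eq_zero]
    · split_ifs <;> simp
    · intro i hi
      rw [if_neg]
      rintro rfl
      simp at hi
  rcases Int.units_eq_one_or (Equiv.Perm.sign σ) with hs | hs <;> simpa [hs] using h

/-- Functions on a set of points induced by polynomials of degree less than `s` in each variable
lie in the span of the corresponding monomial functions. -/
theorem eval_mem_span_of_degreeOf_lt {ι G : Type*} [Fintype ι] (x : G → ι → ℂ) {s : ℕ}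
    (p : MvPolynomial ι ℂ) (hp : ∀ k, degreeOf k p < s) :
    (fun g => eval (x g) p) ∈
      Submodule.span ℂ (Set.range fun (e : ι → Fin s) (g : G) => ∏ i, x g i ^ (e i : ℕ)) := by
  have h : (fun g => eval (x g) p) =
      ∑ d ∈ p.support, coeff d p • fun g => ∏ i, x g i ^ d i := by
    ext g
    simp [eval_eq', Finset.sum_apply]
  rw [h]
  refine Submodule.sum_mem _ fun d hd => Submodule.smul_mem _ _ (Submodule.subset_span ?_)
  exact ⟨fun i => ⟨d i, (degreeOf_lt_iff (Nat.zero_lt_of_lt (hp i))).1 (hp i) d hd⟩, rfl⟩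

/-- Points separated by polynomials of degree less than `s` in each of the variables `ι` number at
most `s ^ |ι|`. -/
theorem card_le_of_separating {ι G : Type*} [Fintype ι] [Fintype G] (x : G → ι → ℂ) {s : ℕ}
    (F : G → MvPolynomial ι ℂ) (hdeg : ∀ h k, degreeOf k (F h) < s)
    (hne : ∀ h, eval (x h) (F h) ≠ 0) (hzero : ∀ g h, g ≠ h → eval (x g) (F h) = 0) :
    Fintype.card G ≤ s ^ Fintype.card ι := by
  classical
  set b := fun (e : ι → Fin s) (g : G) => ∏ i, x g i ^ (e i : ℕ) with hb
  have hspan : Submodule.span ℂ (Set.range b) = ⊤ := by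
    rw [eq_top_iff, ← (Pi.basisFun ℂ G).span_eq, Submodule.span_le]
    rintro _ ⟨h, rfl⟩
    have hmem := Submodule.smul_mem _ (eval (x h) (F h))⁻¹
      (eval_mem_span_of_degreeOf_lt x (F h) (hdeg h))
    have heq : Pi.basisFun ℂ G h = (eval (x h) (F h))⁻¹ • fun g => eval (x g) (F h) := by
      ext g
      by_cases hg : g = h
      · subst hg
        simp [hne]
      · simp [hzero g h hg, hg]
    rw [heq]
    exact hmem
  have hcard := finrank_range_le_card (R := ℂ) b
  rw [Set.finrank, hspan, finrank_top, Module.finrank_fintype_fun_eq_card] at hcard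
  simpa using hcard

end MvPolynomial

open MvPolynomial in
/-- A finite group of matrices whose elements have all their eigenvalues in a finite set `S` has
order at most `|S| ^ (n ^ 2)`. -/
theorem Matrix.card_le_of_eigenvalues_mem {ι G : Type*} [Fintype ι] [DecidableEq ι] [Group G]
    [Fintype G] (ρ : G →* Matrix ι ι ℂ) (hρ : Function.Injective ρ) (S : Finset ℂ) (h1 : 1 ∈ S)
    (hS : ∀ g ζ, (ρ g - algebraMap ℂ _ ζ).det = 0 → ζ ∈ S) :
    Fintype.card G ≤ S.card ^ (Fintype.card ι ^ 2) := by
  classical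
  let M : G → ℂ → Matrix ι ι (MvPolynomial (ι × ι) ℂ) := fun h ζ =>
    Matrix.of fun i j => X (i, j) - C (ζ * ρ h i j)
  let x : G → ι × ι → ℂ := fun g k => ρ g k.1 k.2
  have heval : ∀ g h ζ, eval (x g) (M h ζ).det =
      (ρ h).det * (ρ (h⁻¹ * g) - algebraMap ℂ _ ζ).det := by
    intro g h ζ
    rw [RingHom.map_det, ← Matrix.det_mul, mul_sub, ← map_mul, mul_inv_cancel_left]
    congr 1
    ext i j
    simp [M, x, Algebra.algebraMap_eq_smul_one]
  have hdet : ∀ h, (ρ h).det ≠ 0 := by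
    intro h
    have : (ρ h).det * (ρ h⁻¹).det = 1 := by
      rw [← Matrix.det_mul, ← map_mul, mul_inv_cancel, map_one, Matrix.det_one]
    exact left_ne_zero_of_mul_eq_one this
  have hpos : 0 < S.card := Finset.card_pos.2 ⟨1, h1⟩
  rw [sq, ← Fintype.card_prod]
  refine card_le_of_separating x (fun h => ∏ ζ ∈ S.erase 1, (M h ζ).det) ?_ ?_ ?_
  · intro h k
    refine lt_of_le_of_lt ((degreeOf_prod_le k _ _).trans
      (Finset.sum_le_card_nsmul _ _ 1 fun ζ _ => degreeOf_det_le_one _ ?_ k)) ?_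
    · intro i j k
      refine (degreeOf_sub_le _ _ _).trans ?_
      rw [degreeOf_X, degreeOf_C, max_eq_left (Nat.zero_le _)]
    · rw [Finset.card_erase_of_mem h1, smul_eq_mul, mul_one]
      exact Nat.sub_lt hpos one_pos
  · intro h
    rw [map_prod, Finset.prod_ne_zero_iff]
    intro ζ hζ
    rw [heval, inv_mul_cancel, map_one, ← map_one (algebraMap ℂ (Matrix ι ι ℂ)), ← map_sub,
      Algebra.algebraMap_eq_smul_one, Matrix.det_smul, Matrix.det_one, mul_one]
    exact mul_ne_zero (hdet h) (pow_ne_zero _ (sub_ne_zero.2 (Finset.ne_of_mem_erase hζ).symm))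
  · intro g h hgh
    rw [map_prod, Finset.prod_eq_zero_iff]
    by_contra! hcon
    have hone : ρ (h⁻¹ * g) = 1 := by
      refine eq_one_of_pow_eq_one_of_forall_isUnit (N := Fintype.card G) Fintype.card_pos
        (by rw [← map_pow, pow_card_eq_one, map_one]) fun ζ hζ => ?_
      rw [Matrix.isUnit_iff_isUnit_det, isUnit_iff_ne_zero]
      intro h0
      refine hcon ζ (Finset.mem_erase.2 ⟨hζ, hS _ _ h0⟩) ?_
      rw [heval, h0, mul_zero]
    rw [← map_one ρ] at hone
    exact hgh (inv_mul_eq_one.1 (hρ hone)).symm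

theorem finrank_adjoin_of_pow_eq_one {ζ : ℂ} {N : ℕ} (hN : 0 < N) (h : ζ ^ N = 1) :
    Module.finrank ℚ ↥(IntermediateField.adjoin ℚ {ζ}) = (orderOf ζ).totient := by
  have hpos : 0 < orderOf ζ := (isOfFinOrder_iff_pow_eq_one.2 ⟨N, hN, h⟩).orderOf_pos
  have hprim := IsPrimitiveRoot.orderOf ζ
  rw [IntermediateField.adjoin.finrank ((hprim.isIntegral hpos).tower_top),
    ← Polynomial.cyclotomic_eq_minpoly_rat hprim hpos, Polynomial.natDegree_cyclotomic]

/-- The complex roots of unity of order less than `N` and degree at most `d` over `ℚ`. -/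
noncomputable def rootsOfUnityOfDegreeLE (N d : ℕ) : Finset ℂ :=
  {m ∈ Finset.range N | True ∧ m.totient ≤ d}.biUnion fun m => primitiveRoots m ℂ

theorem card_rootsOfUnityOfDegreeLE {N d : ℕ} (h : d < N) :
    (rootsOfUnityOfDegreeLE N d).card ≤ 2 * d ^ 2 :=
  Finset.card_biUnion_le.trans
    ((Finset.sum_le_sum fun m _ => (Complex.card_primitiveRoots m).le).trans (totientSum_le h))

theorem mem_rootsOfUnityOfDegreeLE {ζ : ℂ} {N d k : ℕ} (hk : 0 < k) (hkN : k < N) (h : ζ ^ k = 1)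
    (hd : Module.finrank ℚ ↥(IntermediateField.adjoin ℚ {ζ}) ≤ d) :
    ζ ∈ rootsOfUnityOfDegreeLE N d := by
  rw [finrank_adjoin_of_pow_eq_one hk h] at hd
  have hpos : 0 < orderOf ζ := (isOfFinOrder_iff_pow_eq_one.2 ⟨k, hk, h⟩).orderOf_pos
  have hle := orderOf_le_of_pow_eq_one hk h
  exact Finset.mem_biUnion.2 ⟨orderOf ζ, Finset.mem_filter.2
    ⟨Finset.mem_range.2 (hle.trans_lt hkN), trivial, hd⟩,
    (mem_primitiveRoots hpos).2 (IsPrimitiveRoot.orderOf ζ)⟩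

theorem bfs_of_bounded_eigenvalue_degree (V : Type*) [AddCommGroup V] [Module ℂ V]
    [FiniteDimensional ℂ V] (n C : ℕ) (hdim : Module.finrank ℂ V = n)
    (Γ : Subgroup (V ≃ₗ[ℂ] V))
    (hC : ∀ g ∈ Γ, ∀ α : ℂ, Module.End.HasEigenvalue (↑g : V →ₗ[ℂ] V) α →
      Module.finrank ℚ ↥(IntermediateField.adjoin ℚ {α}) ≤ C)
    (H : Subgroup (V ≃ₗ[ℂ] V)) (hH : H ≤ Γ) (hfin : Finite H) :
    Nat.card H ≤ 2 ^ (n ^ 2) * C ^ (2 * n ^ 2) := by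
  rcases Nat.eq_zero_or_pos n with rfl | hn
  · have : Subsingleton V := Module.finrank_zero_iff.1 hdim
    have : Subsingleton H := ⟨fun a b => Subtype.ext (LinearEquiv.ext fun v => Subsingleton.elim _ _)⟩
    simp
  have : Fintype H := Fintype.ofFinite H
  let b : Module.Basis (Fin n) ℂ V := Module.finBasisOfFinrankEq ℂ V hdim
  let ρ : H →* Matrix (Fin n) (Fin n) ℂ :=
    ((LinearMap.toMatrixAlgEquiv b : (V →ₗ[ℂ] V) →* Matrix (Fin n) (Fin n) ℂ).comp
      LinearEquiv.automorphismGroup.toLinearMapMonoidHom).comp H.subtype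
  have hρ : Function.Injective ρ := fun a c hac =>
    Subtype.ext (LinearEquiv.toLinearMap_injective ((LinearMap.toMatrixAlgEquiv b).injective hac))
  have hpow : ∀ (g : H) (ζ : ℂ), Module.End.HasEigenvalue ((g : V ≃ₗ[ℂ] V) : V →ₗ[ℂ] V) ζ →
      ζ ^ Fintype.card H = 1 := by
    intro g ζ h
    obtain ⟨v, hv⟩ := h.exists_hasEigenvector
    have h1 := hv.pow_apply (Fintype.card H)
    have h2 : ((g : V ≃ₗ[ℂ] V) : V →ₗ[ℂ] V) ^ Fintype.card H = 1 := by
      have h3 : (g : V ≃ₗ[ℂ] V) ^ Fintype.card H = 1 := by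
        rw [← Subgroup.coe_pow, pow_card_eq_one, Subgroup.coe_one]
      have h4 := congrArg LinearEquiv.automorphismGroup.toLinearMapMonoidHom h3
      rwa [map_pow, map_one] at h4
    rw [h2, Module.End.one_apply] at h1
    refine sub_eq_zero.1 ((smul_eq_zero.1 ?_).resolve_right hv.2)
    rw [sub_smul, ← h1, one_smul, sub_self]
  set N := Fintype.card H + C + 1 with hN
  have hmem : ∀ (g : H) (ζ : ℂ), Module.End.HasEigenvalue ((g : V ≃ₗ[ℂ] V) : V →ₗ[ℂ] V) ζ →
      ζ ∈ rootsOfUnityOfDegreeLE N C := fun g ζ h =>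
    mem_rootsOfUnityOfDegreeLE Fintype.card_pos (by omega) (hpow g ζ h) (hC g (hH g.2) ζ h)
  have h1 : (1 : ℂ) ∈ rootsOfUnityOfDegreeLE N C := by
    have : Nontrivial V := Module.nontrivial_of_finrank_pos (R := ℂ) (hdim ▸ hn)
    obtain ⟨v, hv⟩ := exists_ne (0 : V)
    exact hmem 1 1 (Module.End.hasEigenvalue_of_hasEigenvector
      ⟨Module.End.mem_eigenspace_iff.2 (by simp), hv⟩)
  have hcard := Matrix.card_le_of_eigenvalues_mem ρ hρ _ h1 fun g ζ h0 => hmem g ζ <| by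
    have h2 : ρ g - algebraMap ℂ _ ζ = LinearMap.toMatrixAlgEquiv b
        (((g : V ≃ₗ[ℂ] V) : V →ₗ[ℂ] V) - algebraMap ℂ (Module.End ℂ V) ζ) := by
      rw [map_sub, AlgEquiv.commutes]
      rfl
    have h3 : LinearMap.det
        (((g : V ≃ₗ[ℂ] V) : V →ₗ[ℂ] V) - algebraMap ℂ (Module.End ℂ V) ζ) = 0 := by
      rw [h2] at h0
      rw [← LinearMap.det_toMatrix b]
      exact h0
    rw [Module.End.hasEigenvalue_iff, Module.End.eigenspace_def]
    exact (LinearMap.bot_lt_ker_of_det_eq_zero h3).ne'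
  rw [Fintype.card_fin] at hcard
  rw [Nat.card_eq_fintype_card, pow_mul, ← mul_pow]
  exact hcard.trans (Nat.pow_le_pow_left (card_rootsOfUnityOfDegreeLE (by omega)) _)
end
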